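/- arXiv:2604.22488 — 4 statements merged into one kernel-verified Lean document; each statement's English description precedes it below -/
import Mathlib

section
/- Let 𝓜 be a nonempty subset of 𝔖 bounded from below. If the infimum inf 𝓜 does not exist (i.e., 𝔏(𝓜) has no greatest element), then the set Max 𝔏(𝓜) of maximal lower bounds of 𝓜 is infinite. -/
noncomputable section

variable {H : Type*} [NormedAddCommGroup H] [InnerProductSpace ℂ H] [CompleteSpace H]

/-- The (real) value `(Su, u)` of the quadratic form of a bounded operator `S`
(for self-adjoint `S` the inner product `⟪Su, u⟫` is real, and equals this value). -/
def qform (S : H →L[ℂ] H) (u : H) : ℝ := (inner ℂ (S u) u : ℂ).re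

/-- Löwner's partial order on bounded self-adjoint operators:
`S ≤ T` iff `(Su,u) ≤ (Tu,u)` for all `u ∈ H`. -/
def LoewnerLE (S T : H →L[ℂ] H) : Prop := ∀ u : H, qform S u ≤ qform T u

/-- The set `𝔏(𝓜)` of lower bounds of `M` within the bounded self-adjoint operators. -/
def lowerBoundsSA (M : Set (H →L[ℂ] H)) : Set (H →L[ℂ] H) :=
  {L | IsSelfAdjoint L ∧ ∀ A ∈ M, LoewnerLE L A}

/-- `G` is the greatest element of the set `L` with respect to Löwner's order. -/
def IsGreatestSA (L : Set (H →L[ℂ] H)) (G : H →L[ℂ] H) : Prop :=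
  G ∈ L ∧ ∀ X ∈ L, LoewnerLE X G

/-- `M` is a maximal element of the set `L` with respect to Löwner's order. -/
def IsMaximalSA (L : Set (H →L[ℂ] H)) (M : H →L[ℂ] H) : Prop :=
  M ∈ L ∧ ∀ X ∈ L, LoewnerLE M X → X = M

open Filter Topology in
lemma exists_weak_limit {ι : Type*} (U : Ultrafilter ι) (f : ι → H →L[ℂ] H) (K : ℝ)
    (hK : ∀ᶠ i in (U : Filter ι), ‖f i‖ ≤ K) :
    ∃ T : H →L[ℂ] H, ∀ u v : H,
      Tendsto (fun i => (inner ℂ (f i u) v : ℂ)) U (𝓝 (inner ℂ (T u) v)) := by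
  have hb : ∀ u v : H, ∀ᶠ i in (U : Filter ι), ‖(inner ℂ (f i u) v : ℂ)‖ ≤ K * ‖u‖ * ‖v‖ := by
    intro u v
    filter_upwards [hK] with i hi
    calc ‖(inner ℂ (f i u) v : ℂ)‖ ≤ ‖f i u‖ * ‖v‖ := norm_inner_le_norm _ _
      _ ≤ (‖f i‖ * ‖u‖) * ‖v‖ := by gcongr; exact (f i).le_opNorm u
      _ ≤ K * ‖u‖ * ‖v‖ := by gcongr
  have hlim : ∀ u v : H, ∃ z : ℂ, ‖z‖ ≤ K * ‖u‖ * ‖v‖ ∧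
      Tendsto (fun i => (inner ℂ (f i u) v : ℂ)) U (𝓝 z) := by
    intro u v
    have hc : IsCompact (Metric.closedBall (0 : ℂ) (K * ‖u‖ * ‖v‖)) :=
      isCompact_closedBall _ _
    obtain ⟨z, hz, hz'⟩ := hc.ultrafilter_le_nhds
      (U.map (fun i => (inner ℂ (f i u) v : ℂ))) (by
        rw [Ultrafilter.coe_map, le_principal_iff, mem_map]
        filter_upwards [hb u v] with i hi
        simpa using hi)
    exact ⟨z, by simpa using hz, hz'⟩
  choose B hB hBt using hlim
  let L : H →ₗ⋆[ℂ] H →ₗ[ℂ] ℂ := LinearMap.mk₂'ₛₗ (starRingEnd ℂ) (RingHom.id ℂ) B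
    (fun a b v => tendsto_nhds_unique (hBt (a + b) v) (by
      simpa [inner_add_left] using (hBt a v).add (hBt b v)))
    (fun c a v => tendsto_nhds_unique (hBt (c • a) v) (by
      simpa [inner_smul_left, mul_comm] using (hBt a v).const_mul (starRingEnd ℂ c)))
    (fun u a b => tendsto_nhds_unique (hBt u (a + b)) (by
      simpa [inner_add_right] using (hBt u a).add (hBt u b)))
    (fun c u a => tendsto_nhds_unique (hBt u (c • a)) (by
      simpa [inner_smul_right] using (hBt u a).const_mul c))
  refine ⟨InnerProductSpace.continuousLinearMapOfBilin (L.mkContinuous₂ K hB), fun u v => ?_⟩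
  rw [InnerProductSpace.continuousLinearMapOfBilin_apply]
  exact hBt u v

lemma loewner_iff {S T : H →L[ℂ] H} (hS : IsSelfAdjoint S) (hT : IsSelfAdjoint T) :
    S ≤ T ↔ LoewnerLE S T := by
  rw [ContinuousLinearMap.le_def, ContinuousLinearMap.isPositive_def']
  constructor
  · intro h u
    have := h.2 u
    simp [ContinuousLinearMap.reApplyInnerSelf, inner_sub_left] at this
    exact this
  · intro h
    refine ⟨hT.sub hS, fun u => ?_⟩
    have := h u
    simp only [qform] at this
    simp [ContinuousLinearMap.reApplyInnerSelf, inner_sub_left]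
    exact this

open Filter Topology in
lemma exists_maximal_ge (M : Set (H →L[ℂ] H)) (hne : M.Nonempty)
    (hsa : ∀ A ∈ M, IsSelfAdjoint A) (X : H →L[ℂ] H) (hX : X ∈ lowerBoundsSA M) :
    ∃ m, LoewnerLE X m ∧ IsMaximalSA (lowerBoundsSA M) m := by
  obtain ⟨m, hm1, hm2⟩ := zorn_le_nonempty₀ (lowerBoundsSA M) (by
    intro c hc hchain y hy
    obtain ⟨A, hA⟩ := hne
    haveI : Nonempty c := ⟨⟨y, hy⟩⟩
    haveI : IsDirectedOrder c := ⟨fun a b => by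
      rcases hchain.total a.2 b.2 with h | h
      · exact ⟨b, h, le_refl b⟩
      · exact ⟨a, le_refl a, h⟩⟩
    have hU : ((Ultrafilter.of (atTop : Filter c) : Ultrafilter c) : Filter c) ≤ atTop :=
      Ultrafilter.of_le _
    have hev : ∀ z : c, ∀ᶠ i in ((Ultrafilter.of (atTop : Filter c) : Ultrafilter c) : Filter c),
        z ≤ i := fun z => hU (eventually_ge_atTop z)
    obtain ⟨T, hT⟩ := exists_weak_limit (Ultrafilter.of (atTop : Filter c))
      (fun i => (i : H →L[ℂ] H)) (‖A - y‖ + ‖y‖) (by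
        filter_upwards [hev ⟨y, hy⟩] with i hi
        have h1 : y ≤ (i : H →L[ℂ] H) := hi
        have h2 : (i : H →L[ℂ] H) ≤ A :=
          (loewner_iff (hc i.2).1 (hsa A hA)).2 ((hc i.2).2 A hA)
        have h3 : ‖(i : H →L[ℂ] H) - y‖ ≤ ‖A - y‖ :=
          CStarAlgebra.norm_le_norm_of_nonneg_of_le (sub_nonneg.2 h1) (sub_le_sub_right h2 y)
        calc ‖(i : H →L[ℂ] H)‖ = ‖((i : H →L[ℂ] H) - y) + y‖ := by rw [sub_add_cancel]
          _ ≤ ‖(i : H →L[ℂ] H) - y‖ + ‖y‖ := norm_add_le _ _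
          _ ≤ _ := by gcongr)
    have hq : ∀ u, Tendsto (fun i : c => qform (i : H →L[ℂ] H) u)
        (Ultrafilter.of (atTop : Filter c)) (𝓝 (qform T u)) := fun u =>
      (Complex.continuous_re.tendsto _).comp (hT u u)
    have hTsa : IsSelfAdjoint T := by
      rw [ContinuousLinearMap.isSelfAdjoint_iff_isSymmetric]
      intro u v
      refine tendsto_nhds_unique (hT u v) ?_
      have h := (Complex.continuous_conj.tendsto _).comp (hT v u)
      have e : (starRingEnd ℂ) (inner ℂ (T v) u) = inner ℂ u (T v) := inner_conj_symm _ _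
      rw [e] at h
      refine h.congr fun i => ?_
      have hs := (ContinuousLinearMap.isSelfAdjoint_iff_isSymmetric.1 (hc i.2).1) u v
      simp only [Function.comp, inner_conj_symm]
      exact hs.symm
    refine ⟨T, ⟨hTsa, fun A' hA' u => ?_⟩, fun z hz => ?_⟩
    · exact le_of_tendsto (hq u) (Eventually.of_forall fun i => (hc i.2).2 A' hA' u)
    · rw [loewner_iff (hc hz).1 hTsa]
      intro u
      refine ge_of_tendsto (hq u) ?_
      filter_upwards [hev ⟨z, hz⟩] with i hi
      exact (loewner_iff (hc hz).1 (hc i.2).1).1 hi u) X hX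
  refine ⟨m, (loewner_iff hX.1 hm2.1.1).1 hm1, hm2.1, fun Y hY hmY => ?_⟩
  have h := (loewner_iff hm2.1.1 hY.1).2 hmY
  exact le_antisymm (hm2.2 hY h) h

lemma qform_comb (S T : H →L[ℂ] H) (a b : ℝ) (u : H) :
    qform ((a : ℂ) • S + (b : ℂ) • T) u = a * qform S u + b * qform T u := by
  simp [qform, inner_add_left, inner_smul_left]

/-- Fact (2.g): if the infimum of `M` does not exist, the set of maximal lower bounds of `M`
is infinite. -/
theorem stmt2 (M : Set (H →L[ℂ] H)) (hne : M.Nonempty)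
    (hsa : ∀ A ∈ M, IsSelfAdjoint A)
    (hbdd : (lowerBoundsSA M).Nonempty)
    (hninf : ¬ ∃ G, IsGreatestSA (lowerBoundsSA M) G) :
    {X | IsMaximalSA (lowerBoundsSA M) X}.Infinite := by
  intro hfin
  obtain ⟨X0, hX0⟩ := hbdd
  obtain ⟨S, -, hS⟩ := exists_maximal_ge M hne hsa X0 hX0
  have : ∃ T, IsMaximalSA (lowerBoundsSA M) T ∧ T ≠ S := by
    by_contra! hcon
    refine hninf ⟨S, hS.1, fun X hX => ?_⟩
    obtain ⟨m, h1, h2⟩ := exists_maximal_ge M hne hsa X hX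
    rwa [hcon m h2] at h1
  obtain ⟨T, hT, hTS⟩ := this
  let t : ℕ → ℝ := fun n => 1 / ((n : ℝ) + 1)
  have ht0 : ∀ n, 0 < t n := fun n => Nat.one_div_pos_of_nat
  have ht1 : ∀ n, t n ≤ 1 := fun n => by
    have : (0 : ℝ) ≤ n := Nat.cast_nonneg n
    exact (div_le_one (by positivity)).2 (by linarith)
  have htl : Filter.Tendsto t Filter.atTop (nhds 0) := tendsto_one_div_add_atTop_nhds_zero_nat
  let Y : ℕ → H →L[ℂ] H := fun n => ((t n : ℝ) : ℂ) • T + ((1 - t n : ℝ) : ℂ) • S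
  have hYq : ∀ n u, qform (Y n) u = t n * qform T u + (1 - t n) * qform S u :=
    fun n u => qform_comb T S _ _ u
  have hY : ∀ n, Y n ∈ lowerBoundsSA M := by
    intro n
    refine ⟨?_, fun A hA u => ?_⟩
    · exact ((IsSelfAdjoint.smul (Complex.conj_ofReal _) hT.1.1)).add
        (IsSelfAdjoint.smul (Complex.conj_ofReal _) hS.1.1)
    · rw [hYq]
      have h1 := hT.1.2 A hA u
      have h2 := hS.1.2 A hA u
      nlinarith [ht0 n, ht1 n]
  choose m hm1 hm2 using fun n => exists_maximal_ge M hne hsa (Y n) (hY n)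
  obtain ⟨R, hR, hRinf⟩ : ∃ R ∈ {X | IsMaximalSA (lowerBoundsSA M) X},
      ∃ᶠ n in Filter.atTop, m n = R := by
    by_contra! hcon
    have h1 : ∀ᶠ n in Filter.atTop, ∀ R ∈ {X | IsMaximalSA (lowerBoundsSA M) X}, ¬ m n = R :=
      (Filter.eventually_all_finite hfin).2 fun R hR => hcon R hR
    obtain ⟨n, hn⟩ := h1.exists
    exact hn (m n) (hm2 n) rfl
  have hSR : LoewnerLE S R := by
    intro u
    have hl : Filter.Tendsto (fun n => qform (Y n) u) Filter.atTop (nhds (qform S u)) := by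
      simp only [hYq]
      simpa using (htl.mul_const (qform T u)).add
        ((htl.const_sub 1).mul_const (qform S u))
    refine le_of_tendsto_of_frequently hl (hRinf.mono fun n hn => ?_)
    rw [← hn]
    exact hm1 n u
  have hRS : R = S := hS.2 R hR.1 hSR
  obtain ⟨n, hn⟩ := hRinf.exists
  refine hTS (hT.2 S hS.1 fun u => ?_).symm
  have h := hm1 n u
  rw [hn, hRS, hYq] at h
  have := ht0 n
  nlinarith
end
end

section
/- Let 𝓜 be a nonempty countable subset of 𝔖 which is compact in the weak-operator topology and bounded from below. Then inf 𝓜 exists if and only if there exists G ∈ 𝓜 such that G ≤ A for all A ∈ 𝓜; in this case G = inf 𝓜. -/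
noncomputable section

variable {H : Type*} [NormedAddCommGroup H] [InnerProductSpace ℂ H] [CompleteSpace H]

/-- The weak-operator topology on bounded operators: the coarsest topology making all maps
`S ↦ ⟪S u, v⟫` continuous, i.e. the topology induced by `S ↦ (fun (u,v) => ⟪S u, v⟫)`. -/
def wotTopology : TopologicalSpace (H →L[ℂ] H) :=
  TopologicalSpace.induced
    (fun S : H →L[ℂ] H => fun p : H × H => (inner ℂ (S p.1) p.2 : ℂ)) inferInstance

lemma qform_add_vec (B : H →L[ℂ] H) (hB : IsSelfAdjoint B) (x w : H) :
    qform B (x + w) = qform B x + 2 * (inner ℂ (B x) w : ℂ).re + qform B w := by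
  have h : (inner ℂ (B w) x : ℂ).re = (inner ℂ (B x) w : ℂ).re := by
    have h1 : (inner ℂ (B w) x : ℂ) = inner ℂ w (B x) := hB.isSymmetric w x
    rw [h1]
    exact inner_re_symm (𝕜 := ℂ) w (B x)
  simp only [qform, map_add, inner_add_left, inner_add_right, Complex.add_re]
  rw [h]; ring

lemma qform_smul_vec (B : H →L[ℂ] H) (a : ℂ) (x : H) :
    qform B (a • x) = ‖a‖ ^ 2 * qform B x := by
  have h : (inner ℂ (B (a • x)) (a • x) : ℂ) = ((‖a‖ ^ 2 : ℝ) : ℂ) * inner ℂ (B x) x := by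
    rw [map_smul, inner_smul_left, inner_smul_right, ← mul_assoc, Complex.conj_mul']
    push_cast; ring
  simp only [qform]
  rw [h, Complex.re_ofReal_mul]

lemma qform_add (A B : H →L[ℂ] H) (x : H) : qform (A + B) x = qform A x + qform B x := by
  simp [qform, inner_add_left]

lemma qform_sub (A B : H →L[ℂ] H) (x : H) : qform (A - B) x = qform A x - qform B x := by
  simp [qform, inner_sub_left]

lemma continuous_qform (B : H →L[ℂ] H) : Continuous (qform B) := by
  unfold qform
  fun_prop

lemma exists_pos_vec (M : Set (H →L[ℂ] H)) (hcount : M.Countable) (G : H →L[ℂ] H)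
    (hG : ∀ A ∈ M, LoewnerLE G A) (hno : ∀ A ∈ M, ¬ LoewnerLE A G) :
    ∃ u : H, ∀ A ∈ M, qform G u < qform A u := by
  have hd : Dense (⋂ A ∈ M, {u : H | qform G u < qform A u}) := by
    refine dense_biInter_of_isOpen (fun A _ => isOpen_lt (continuous_qform G) (continuous_qform A))
      hcount (fun A hA => ?_)
    rw [← compl_compl {u : H | qform G u < qform A u}, ← interior_eq_empty_iff_dense_compl]
    rw [Set.eq_empty_iff_forall_notMem]
    intro x hx
    apply hno A hA
    intro v
    have hx' : ∀ᶠ y in nhds x, qform A y ≤ qform G y := by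
      filter_upwards [mem_interior_iff_mem_nhds.1 hx] with y hy
      simpa using hy
    have t1 : Filter.Tendsto (fun t : ℝ => x + (t : ℂ) • v) (nhdsWithin 0 (Set.Ioi 0)) (nhds x) := by
      have : Continuous (fun t : ℝ => x + (t : ℂ) • v) := by fun_prop
      have h := this.tendsto 0
      simp only [Complex.ofReal_zero, zero_smul, add_zero] at h
      exact h.mono_left nhdsWithin_le_nhds
    have t2 : Filter.Tendsto (fun t : ℝ => x + (t : ℂ) • (-v)) (nhdsWithin 0 (Set.Ioi 0))
        (nhds x) := by
      have : Continuous (fun t : ℝ => x + (t : ℂ) • (-v)) := by fun_prop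
      have h := this.tendsto 0
      simp only [Complex.ofReal_zero, zero_smul, add_zero] at h
      exact h.mono_left nhdsWithin_le_nhds
    obtain ⟨t, ⟨h1, h2⟩, h3⟩ :=
      (((t1.eventually hx').and (t2.eventually hx')).and self_mem_nhdsWithin).exists
    have hpar : ∀ B : H →L[ℂ] H, qform B (x + (t : ℂ) • v) + qform B (x + (t : ℂ) • (-v))
        = 2 * qform B x + 2 * (t ^ 2 * qform B v) := by
      intro B
      have := qform_smul_vec B (t : ℂ) v
      rw [Complex.norm_real, Real.norm_eq_abs, sq_abs] at this
      rw [← this]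
      simp only [qform, smul_neg, map_add, map_neg, inner_add_left, inner_add_right,
        inner_neg_left, inner_neg_right, Complex.add_re, Complex.neg_re]
      ring
    have hA1 := hpar A
    have hG1 := hpar G
    have hx0 := hG A hA x
    have ht : 0 < t ^ 2 := pow_pos h3 2
    have : t ^ 2 * qform A v ≤ t ^ 2 * qform G v := by linarith
    exact le_of_mul_le_mul_left this ht
  obtain ⟨u, hu⟩ := hd.nonempty
  exact ⟨u, by simpa using hu⟩

lemma wot_eval_bdd (M : Set (H →L[ℂ] H)) (hcomp : @IsCompact _ wotTopology M) (u v : H) :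
    IsCompact ((fun A : H →L[ℂ] H => (inner ℂ (A u) v : ℂ)) '' M) := by
  have h := @IsCompact.image _ _ wotTopology _ M _ hcomp
    (@continuous_induced_dom _ _ (fun S : H →L[ℂ] H => fun p : H × H => (inner ℂ (S p.1) p.2 : ℂ)) _)
  have h2 := h.image (continuous_apply ((u, v) : H × H))
  rw [Set.image_image] at h2
  exact h2

lemma wot_bdd (M : Set (H →L[ℂ] H)) (hcomp : @IsCompact _ wotTopology M) (u : H) :
    ∃ C, ∀ A ∈ M, ‖A u‖ ≤ C := by
  obtain ⟨C, hC⟩ := banach_steinhaus (g := fun A : M => innerSL ℂ (A.1 u)) (by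
    intro v
    obtain ⟨C, hC⟩ := (wot_eval_bdd M hcomp u v).isBounded.exists_norm_le
    exact ⟨C, fun A => hC _ ⟨A.1, A.2, rfl⟩⟩)
  exact ⟨C, fun A hA => by simpa using hC ⟨A, hA⟩⟩

lemma mem_of_inf (M : Set (H →L[ℂ] H)) (hne : M.Nonempty)
    (hsa : ∀ A ∈ M, IsSelfAdjoint A) (hcount : M.Countable)
    (hcomp : @IsCompact _ wotTopology M) (G : H →L[ℂ] H)
    (hG : IsGreatestSA (lowerBoundsSA M) G) : ∃ A ∈ M, LoewnerLE A G := by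
  by_contra! hno
  obtain ⟨⟨hGsa, hGl⟩, hGg⟩ := hG
  obtain ⟨u₀, hu₀⟩ := exists_pos_vec M hcount G hGl hno
  have hu₀0 : u₀ ≠ 0 := by
    rintro rfl
    obtain ⟨A, hA⟩ := hne
    simpa [qform] using hu₀ A hA
  obtain ⟨u, hu1, hu⟩ : ∃ u : H, ‖u‖ = 1 ∧ ∀ A ∈ M, qform G u < qform A u := by
    refine ⟨((‖u₀‖⁻¹ : ℝ) : ℂ) • u₀, ?_, fun A hA => ?_⟩
    · rw [norm_smul]; simp [hu₀0]
    · rw [qform_smul_vec, qform_smul_vec]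
      have : 0 < ‖u₀‖ := norm_pos_iff.2 hu₀0
      have := hu₀ A hA
      gcongr
      simp [hu₀0]
  obtain ⟨c, hc, hcA⟩ : ∃ c > 0, ∀ A ∈ M, c ≤ qform (A - G) u := by
    have hk := (wot_eval_bdd M hcomp u u).image Complex.continuous_re
    obtain ⟨m, ⟨_, ⟨A, hA, rfl⟩, rfl⟩, hm⟩ := hk.exists_isLeast ((hne.image _).image _)
    refine ⟨qform (A - G) u, by rw [qform_sub]; linarith [hu A hA], fun A' hA' => ?_⟩
    have : qform A u ≤ qform A' u := hm ⟨_, ⟨A', hA', rfl⟩, rfl⟩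
    rw [qform_sub, qform_sub]; linarith
  obtain ⟨C, hC⟩ := wot_bdd M hcomp u
  set K := C + ‖G u‖ with hK
  have hKA : ∀ A ∈ M, ‖(A - G) u‖ ≤ K := fun A hA =>
    (norm_sub_le (A u) (G u)).trans (by linarith [hC A hA])
  set s : ℝ := 2 * K ^ 2 / c with hs
  set P : H →L[ℂ] H := (innerSL ℂ u).smulRight u with hP
  set X : H →L[ℂ] H := G + (((c / 2 + s : ℝ) : ℂ) • P - ((s : ℝ) : ℂ) • (1 : H →L[ℂ] H)) with hX
  have hXq : ∀ v, qform X v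
      = qform G v + ((c / 2 + s) * ‖(inner ℂ u v : ℂ)‖ ^ 2 - s * ‖v‖ ^ 2) := by
    intro v
    rw [hX, qform_add, qform_sub]
    congr 2
    · have : (inner ℂ ((((c / 2 + s : ℝ) : ℂ) • P) v) v : ℂ)
          = (((c / 2 + s) * ‖(inner ℂ u v : ℂ)‖ ^ 2 : ℝ) : ℂ) := by
        simp only [hP, ContinuousLinearMap.smul_apply, ContinuousLinearMap.smulRight_apply,
          innerSL_apply_apply, inner_smul_left, Complex.conj_ofReal, Complex.conj_mul']
        push_cast; ring
      rw [qform, this, Complex.ofReal_re]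
    · have : (inner ℂ ((((s : ℝ) : ℂ) • (1 : H →L[ℂ] H)) v) v : ℂ)
          = ((s * ‖v‖ ^ 2 : ℝ) : ℂ) := by
        simp only [ContinuousLinearMap.smul_apply, ContinuousLinearMap.one_apply,
          inner_smul_left, Complex.conj_ofReal, inner_self_eq_norm_sq_to_K]
        push_cast; rfl
      rw [qform, this, Complex.ofReal_re]
  have hXsa : IsSelfAdjoint X := by
    have hPs : IsSelfAdjoint P := by
      rw [ContinuousLinearMap.isSelfAdjoint_iff_isSymmetric]
      intro x y
      simp [hP, inner_smul_left, inner_smul_right, mul_comm]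
    have hr : ∀ r : ℝ, IsSelfAdjoint (r : ℂ) := fun r => Complex.conj_ofReal r
    exact hGsa.add (((hr _).smul hPs).sub ((hr _).smul (IsSelfAdjoint.one _)))
  have hXl : X ∈ lowerBoundsSA M := by
    refine ⟨hXsa, fun A hA v => ?_⟩
    rw [hXq]
    have hBsa : IsSelfAdjoint (A - G) := (hsa A hA).sub hGsa
    set a : ℂ := inner ℂ u v with ha
    set w := v - a • u with hw
    have hv : v = a • u + w := by simp [hw]
    have horth : (inner ℂ (a • u) w : ℂ) = 0 := by
      have huu : (inner ℂ u u : ℂ) = 1 := by simp [hu1]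
      rw [hw, inner_smul_left, inner_sub_right, inner_smul_right, ← ha, huu]
      ring
    have hnv : ‖v‖ ^ 2 = ‖a‖ ^ 2 + ‖w‖ ^ 2 := by
      have := norm_add_sq_eq_norm_sq_add_norm_sq_of_inner_eq_zero (a • u) w horth
      rw [← hv, norm_smul, hu1, mul_one] at this
      nlinarith
    have hq : qform (A - G) v = ‖a‖ ^ 2 * qform (A - G) u
        + 2 * (inner ℂ ((A - G) (a • u)) w : ℂ).re + qform (A - G) w := by
      rw [← qform_smul_vec, ← qform_add_vec _ hBsa, ← hv]
    have hw0 : 0 ≤ qform (A - G) w := by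
      rw [qform_sub]; linarith [hGl A hA w]
    have hcross : -(‖a‖ * K * ‖w‖) ≤ (inner ℂ ((A - G) (a • u)) w : ℂ).re := by
      have h1 := (Complex.abs_re_le_norm _).trans (norm_inner_le_norm (𝕜 := ℂ) ((A - G) (a • u)) w)
      have h2 : ‖(A - G) (a • u)‖ * ‖w‖ ≤ ‖a‖ * K * ‖w‖ := by
        rw [map_smul, norm_smul]
        gcongr
        exact hKA A hA
      exact (abs_le.1 (h1.trans h2)).1
    have hcu : ‖a‖ ^ 2 * c ≤ ‖a‖ ^ 2 * qform (A - G) u := by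
      gcongr
      exact hcA A hA
    have hsq : 2 * (‖a‖ * K * ‖w‖) ≤ c / 2 * ‖a‖ ^ 2 + s * ‖w‖ ^ 2 := by
      have : c / 2 * ‖a‖ ^ 2 + s * ‖w‖ ^ 2 - 2 * (‖a‖ * K * ‖w‖)
          = (c * ‖a‖ - 2 * K * ‖w‖) ^ 2 / (2 * c) := by
        rw [hs]; field_simp; ring
      have h0 : 0 ≤ (c * ‖a‖ - 2 * K * ‖w‖) ^ 2 / (2 * c) := by positivity
      linarith
    rw [qform_sub] at hq
    rw [hnv]
    nlinarith
  have h := hGg X hXl u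
  rw [hXq] at h
  have : (inner ℂ u u : ℂ) = 1 := by simp [hu1]
  rw [this, hu1] at h
  norm_num at h
  linarith

/-- Corollary 3.4 (generalized Kadison theorem): for a nonempty countable, weak-operator
compact set `M` bounded from below, the infimum of `M` exists iff `M` contains a lower bound
`G` of `M`; in this case `G` is the greatest lower bound. -/
theorem stmt5 (M : Set (H →L[ℂ] H)) (hne : M.Nonempty)
    (hsa : ∀ A ∈ M, IsSelfAdjoint A)
    (hcount : M.Countable)
    (hcomp : @IsCompact _ wotTopology M)
    (hbdd : (lowerBoundsSA M).Nonempty) :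
    ((∃ G, IsGreatestSA (lowerBoundsSA M) G) ↔ ∃ G ∈ M, ∀ A ∈ M, LoewnerLE G A) ∧
    (∀ G ∈ M, (∀ A ∈ M, LoewnerLE G A) → IsGreatestSA (lowerBoundsSA M) G) := by
  have key : ∀ G ∈ M, (∀ A ∈ M, LoewnerLE G A) → IsGreatestSA (lowerBoundsSA M) G :=
    fun G hG h => ⟨⟨hsa G hG, h⟩, fun X hX => hX.2 G hG⟩
  refine ⟨⟨?_, fun ⟨G, hG, h⟩ => ⟨G, key G hG h⟩⟩, key⟩
  rintro ⟨G, hG⟩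
  obtain ⟨A, hA, hAG⟩ := mem_of_inf M hne hsa hcount hcomp G hG
  exact ⟨A, hA, fun B hB u => (hAG u).trans (hG.1.2 B hB u)⟩
end
end

section
/- Let 𝓜 be a nonempty subset of 𝔖 and M ∈ 𝔏(𝓜). (i) If ⋂_{A ∈ 𝓜} Ran((A−M)^{1/2}) = {0}, then M is a maximal lower bound of 𝓜. (ii) If, additionally, 𝓜 is a finite set and ⋂_{A ∈ 𝓜} Ran((A−M)^{1/2}) ≠ {0}, then M is not a maximal element of 𝔏(𝓜). -/
set_option synthInstance.maxHeartbeats 400000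
set_option maxHeartbeats 800000

noncomputable section

variable {H : Type*} [NormedAddCommGroup H] [InnerProductSpace ℂ H] [CompleteSpace H]

lemma aux_range (T : H →L[ℂ] H) (hT : IsSelfAdjoint T) (v : H) (C : ℝ)
    (h : ∀ u, ‖(inner ℂ v u : ℂ)‖ ≤ C * ‖T u‖) : v ∈ Set.range ⇑T := by
  obtain ⟨s, hs⟩ := T.toLinearMap.rangeRestrict.exists_rightInverse_of_surjective
    (LinearMap.range_rangeRestrict _)
  have hs' : ∀ y, T (s y) = (y : H) := fun y => by
    have := congrArg Subtype.val (LinearMap.congr_fun hs y)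
    simpa using this
  let f : StrongDual ℂ (LinearMap.range T.toLinearMap) :=
    LinearMap.mkContinuous ((innerSL ℂ v).toLinearMap ∘ₗ s) C (fun y => by
      have := h (s y)
      rw [hs'] at this
      simpa using this)
  obtain ⟨g, hg, -⟩ := exists_extension_norm_eq _ f
  refine ⟨(InnerProductSpace.toDual ℂ H).symm g, ?_⟩
  refine ext_inner_right ℂ fun u => ?_
  have h1 : (inner ℂ (T ((InnerProductSpace.toDual ℂ H).symm g)) u : ℂ) = g (T u) := by
    rw [← ContinuousLinearMap.adjoint_inner_right, hT.adjoint_eq,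
      InnerProductSpace.toDual_symm_apply]
  have h2 := hg ⟨T u, ⟨u, rfl⟩⟩
  have h3 := h (s ⟨T u, ⟨u, rfl⟩⟩ - u)
  rw [map_sub, hs'] at h3
  simp only [sub_self, norm_zero, mul_zero, norm_le_zero_iff, inner_sub_right] at h3
  rw [h1]
  refine h2.trans ?_
  rw [← sub_eq_zero, ← h3]
  rfl

lemma aux_sub (S T : H →L[ℂ] H) (u : H) : qform (S - T) u = qform S u - qform T u := by
  simp [qform, inner_sub_left]

lemma aux_nonneg {S T : H →L[ℂ] H} (hS : IsSelfAdjoint S) (hT : IsSelfAdjoint T)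
    (h : LoewnerLE S T) : 0 ≤ T - S := by
  rw [ContinuousLinearMap.nonneg_iff_isPositive, ContinuousLinearMap.isPositive_def']
  refine ⟨hT.sub hS, fun u => ?_⟩
  have := aux_sub T S u
  have := h u
  change 0 ≤ qform (T - S) u
  linarith

lemma aux_sqrt_sa (P : H →L[ℂ] H) : IsSelfAdjoint (CFC.sqrt P) :=
  (CFC.sqrt_nonneg P).isSelfAdjoint

lemma aux_sqrt_inner {P : H →L[ℂ] H} (hP : 0 ≤ P) (w u : H) :
    (inner ℂ (P w) u : ℂ) = inner ℂ (CFC.sqrt P w) (CFC.sqrt P u) := by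
  conv_lhs => rw [← CFC.sqrt_mul_sqrt_self P hP]
  rw [ContinuousLinearMap.mul_apply, ← ContinuousLinearMap.adjoint_inner_right,
    (aux_sqrt_sa P).adjoint_eq]

lemma aux_sqrt {P : H →L[ℂ] H} (hP : 0 ≤ P) (u : H) : qform P u = ‖CFC.sqrt P u‖ ^ 2 := by
  rw [qform, aux_sqrt_inner hP, inner_self_eq_norm_sq_to_K]
  norm_cast

/-- Theorem 4.2: for `Mo ∈ 𝔏(M)`, (i) if `⋂_{A ∈ M} Ran((A - Mo)^{1/2}) = {0}` then `Mo` is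
a maximal lower bound of `M`; (ii) if moreover `M` is finite and the intersection is not
`{0}`, then `Mo` is not maximal. -/
theorem stmt7 (M : Set (H →L[ℂ] H)) (hne : M.Nonempty)
    (hsa : ∀ A ∈ M, IsSelfAdjoint A)
    (Mo : H →L[ℂ] H) (hMo : Mo ∈ lowerBoundsSA M) :
    ((⋂ A ∈ M, Set.range ⇑(CFC.sqrt (A - Mo))) = {0} →
      IsMaximalSA (lowerBoundsSA M) Mo) ∧
    (M.Finite → (⋂ A ∈ M, Set.range ⇑(CFC.sqrt (A - Mo))) ≠ {0} →
      ¬ IsMaximalSA (lowerBoundsSA M) Mo) := by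
  obtain ⟨hMs, hMl⟩ := hMo
  constructor
  · intro hI
    refine ⟨⟨hMs, hMl⟩, fun X hX hMX => ?_⟩
    have hD := aux_nonneg hMs hX.1 hMX
    rw [← sub_eq_zero]
    ext w
    have : (X - Mo) w ∈ ⋂ A ∈ M, Set.range ⇑(CFC.sqrt (A - Mo)) := by
      simp only [Set.mem_iInter]
      intro A hA
      have hP := aux_nonneg hMs (hsa A hA) (hMl A hA)
      refine aux_range _ (aux_sqrt_sa _) _ ‖CFC.sqrt (X - Mo) w‖ fun u => ?_
      rw [aux_sqrt_inner hD]
      refine (norm_inner_le_norm _ _).trans ?_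
      refine mul_le_mul_of_nonneg_left ?_ (norm_nonneg _)
      refine (pow_le_pow_iff_left₀ (norm_nonneg _) (norm_nonneg _) two_ne_zero).1 ?_
      rw [← aux_sqrt hD, ← aux_sqrt hP, aux_sub, aux_sub]
      have := hX.2 A hA u
      linarith
    rw [hI] at this
    simpa using this
  · intro hfin hI hmax
    obtain ⟨v, hv, hv0⟩ : ∃ v ∈ ⋂ A ∈ M, Set.range ⇑(CFC.sqrt (A - Mo)), v ≠ 0 := by
      by_contra hcon
      push Not at hcon
      refine hI (Set.Subset.antisymm (fun x hx => hcon x hx) ?_)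
      rintro x rfl
      simp only [Set.mem_iInter]
      exact fun A _ => ⟨0, map_zero _⟩
    simp only [Set.mem_iInter] at hv
    choose! z hz using hv
    obtain ⟨C, hC⟩ := (hfin.image (fun A => ‖z A‖ ^ 2)).bddAbove
    have hCA : ∀ A ∈ M, ‖z A‖ ^ 2 ≤ C := fun A hA => hC ⟨A, hA, rfl⟩
    have hC0 : 0 ≤ C := by
      obtain ⟨A, hA⟩ := hne
      exact (sq_nonneg _).trans (hCA A hA)
    let R : H →L[ℂ] H := InnerProductSpace.rankOne ℂ v v
    have hRpos : R.IsPositive := InnerProductSpace.isPositive_rankOne_self v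
    let c : ℝ := (1 + C)⁻¹
    have hc : 0 < c := by positivity
    let X : H →L[ℂ] H := Mo + (c : ℂ) • R
    have hcR : ((c : ℂ) • R).IsPositive :=
      hRpos.smul_of_nonneg (by exact_mod_cast hc.le)
    have hq : ∀ u, qform X u = qform Mo u + c * ‖(inner ℂ v u : ℂ)‖ ^ 2 := by
      intro u
      have h1 : X u = Mo u + (c : ℂ) • ((inner ℂ v u : ℂ) • v) := rfl
      rw [qform, h1, inner_add_left, inner_smul_left, inner_smul_left, Complex.add_re,
        Complex.conj_ofReal, Complex.re_ofReal_mul, RCLike.conj_mul, qform]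
      norm_cast
    have hX : X ∈ lowerBoundsSA M := by
      refine ⟨hMs.add hcR.isSelfAdjoint, fun A hA u => ?_⟩
      have hP := aux_nonneg hMs (hsa A hA) (hMl A hA)
      have h1 : ‖(inner ℂ v u : ℂ)‖ ≤ ‖z A‖ * ‖CFC.sqrt (A - Mo) u‖ := by
        rw [← hz A hA, ← ContinuousLinearMap.adjoint_inner_right, (aux_sqrt_sa _).adjoint_eq]
        exact norm_inner_le_norm _ _
      have h2 : ‖(inner ℂ v u : ℂ)‖ ^ 2 ≤ C * qform (A - Mo) u := by
        rw [aux_sqrt hP]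
        calc _ ≤ (‖z A‖ * ‖CFC.sqrt (A - Mo) u‖) ^ 2 := by gcongr
          _ = ‖z A‖ ^ 2 * ‖CFC.sqrt (A - Mo) u‖ ^ 2 := mul_pow _ _ _
          _ ≤ _ := by gcongr; exact hCA A hA
      have h0 : 0 ≤ qform (A - Mo) u := by rw [aux_sqrt hP]; positivity
      have h3 : c * ‖(inner ℂ v u : ℂ)‖ ^ 2 ≤ qform (A - Mo) u := by
        change (1 + C)⁻¹ * _ ≤ _
        rw [inv_mul_le_iff₀ (by positivity)]
        linarith
      rw [aux_sub] at h3
      rw [hq]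
      linarith
    have hXM : X = Mo := hmax.2 X hX fun u => by
      rw [hq]
      have : 0 ≤ c * ‖(inner ℂ v u : ℂ)‖ ^ 2 := by positivity
      linarith
    have h5 := hq v
    rw [hXM] at h5
    have h6 : (inner ℂ v v : ℂ) ≠ 0 := inner_self_ne_zero.mpr hv0
    have : 0 < c * ‖(inner ℂ v v : ℂ)‖ ^ 2 := by positivity
    linarith
end
end

section
/- Let 𝓜 be a nonempty subset of 𝔖⁺ such that γ := inf{ (Au,u) : A ∈ 𝓜, u ∈ 𝓗, ‖u‖ = 1 } > 0. Then 𝔏(𝓜) has a greatest element if and only if 𝔏⁺(𝓜) := 𝔏(𝓜) ∩ 𝔖⁺ has a greatest element, and in this case the two greatest elements coincide. -/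
noncomputable section

variable {H : Type*} [NormedAddCommGroup H] [InnerProductSpace ℂ H] [CompleteSpace H]

theorem qform_add' (S T : H →L[ℂ] H) (u : H) : qform (S + T) u = qform S u + qform T u := by
  simp [qform, inner_add_left]

theorem qform_rsmul (t : ℝ) (S : H →L[ℂ] H) (u : H) :
    qform ((t : ℂ) • S) u = t * qform S u := by
  simp [qform, inner_smul_left]

theorem qform_zero' (u : H) : qform (0 : H →L[ℂ] H) u = 0 := by
  simp [qform]

theorem qform_one' (u : H) : qform (1 : H →L[ℂ] H) u = ‖u‖ ^ 2 := by
  have := inner_self_eq_norm_sq (𝕜 := ℂ) u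
  simpa [qform] using this

theorem qform_vec (t : ℝ) (S : H →L[ℂ] H) (u : H) :
    qform S ((t : ℂ) • u) = t ^ 2 * qform S u := by
  simp [qform, inner_smul_left, inner_smul_right]
  ring

theorem neg_le_qform (S : H →L[ℂ] H) (u : H) : -(‖S‖ * ‖u‖ ^ 2) ≤ qform S u := by
  have h1 : |qform S u| ≤ ‖inner ℂ (S u) u‖ := Complex.abs_re_le_norm _
  have h2 : ‖inner ℂ (S u) u‖ ≤ ‖S u‖ * ‖u‖ := norm_inner_le_norm _ _
  have h3 : ‖S u‖ * ‖u‖ ≤ ‖S‖ * ‖u‖ * ‖u‖ :=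
    mul_le_mul_of_nonneg_right (S.le_opNorm u) (norm_nonneg _)
  have h4 := neg_abs_le (qform S u)
  nlinarith

theorem loewner_antisymm {S T : H →L[ℂ] H} (hS : IsSelfAdjoint S) (hT : IsSelfAdjoint T)
    (h1 : LoewnerLE S T) (h2 : LoewnerLE T S) : S = T := by
  have im0 : ∀ {R : H →L[ℂ] H}, IsSelfAdjoint R → ∀ u, (inner ℂ (R u) u : ℂ).im = 0 := by
    intro R hR u
    have h := hR.isSymmetric u u
    have h' := inner_conj_symm (𝕜 := ℂ) (R u) u
    simp only [ContinuousLinearMap.coe_coe] at h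
    rw [← h] at h'
    exact Complex.conj_eq_iff_im.1 h'
  have key : (S : H →ₗ[ℂ] H) = T := by
    rw [← ext_inner_map]
    intro u
    apply Complex.ext
    · exact le_antisymm (h1 u) (h2 u)
    · exact (im0 hS u).trans (im0 hT u).symm
  exact ContinuousLinearMap.coe_injective key

/-- Theorem 6.7a: if `γ = inf {(Au,u) : A ∈ M, ‖u‖ = 1} > 0` for a nonempty set `M` of
positive operators, then `𝔏(M)` has a greatest element iff `𝔏⁺(M) = 𝔏(M) ∩ 𝔖⁺` has a
greatest element, and in this case the two greatest elements coincide. -/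
theorem stmt19 (M : Set (H →L[ℂ] H)) (hne : M.Nonempty)
    (hpos : ∀ A ∈ M, IsSelfAdjoint A ∧ LoewnerLE 0 A)
    (hγ : 0 < sInf {r : ℝ | ∃ A ∈ M, ∃ u : H, ‖u‖ = 1 ∧ qform A u = r}) :
    ((∃ G, IsGreatestSA (lowerBoundsSA M) G) ↔
      ∃ G, IsGreatestSA {L ∈ lowerBoundsSA M | LoewnerLE 0 L} G) ∧
    (∀ G G', IsGreatestSA (lowerBoundsSA M) G →
      IsGreatestSA {L ∈ lowerBoundsSA M | LoewnerLE 0 L} G' → G = G') := by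
  set γ := sInf {r : ℝ | ∃ A ∈ M, ∃ u : H, ‖u‖ = 1 ∧ qform A u = r} with hγd
  have h0 : (0 : H →L[ℂ] H) ∈ lowerBoundsSA M := ⟨IsSelfAdjoint.zero _, fun A hA => (hpos A hA).2⟩
  have fwd : ∀ G, IsGreatestSA (lowerBoundsSA M) G →
      IsGreatestSA {L ∈ lowerBoundsSA M | LoewnerLE 0 L} G :=
    fun G hG => ⟨⟨hG.1, hG.2 0 h0⟩, fun X hX => hG.2 X hX.1⟩
  have sasmul : ∀ (t : ℝ) {S : H →L[ℂ] H}, IsSelfAdjoint S → IsSelfAdjoint ((t : ℂ) • S) :=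
    fun t S hS => IsSelfAdjoint.smul (Complex.conj_ofReal t) hS
  have hlow : ∀ A ∈ M, ∀ u : H, γ * ‖u‖ ^ 2 ≤ qform A u := by
    intro A hA u
    by_cases hu : u = 0
    · subst hu; simp [qform]
    have hn : 0 < ‖u‖ := norm_pos_iff.2 hu
    have hb : γ ≤ qform A (((‖u‖⁻¹ : ℝ) : ℂ) • u) := by
      refine csInf_le ⟨0, ?_⟩ ⟨A, hA, _, ?_, rfl⟩
      · rintro r ⟨B, hB, v, -, rfl⟩
        have := (hpos B hB).2 v
        rwa [qform_zero'] at this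
      · rw [norm_smul, Complex.norm_real, norm_inv, norm_norm, inv_mul_cancel₀ hn.ne']
    rw [qform_vec] at hb
    calc γ * ‖u‖ ^ 2 ≤ (‖u‖⁻¹ ^ 2 * qform A u) * ‖u‖ ^ 2 := by gcongr
      _ = qform A u := by field_simp
  refine ⟨⟨fun ⟨G, hG⟩ => ⟨G, fwd G hG⟩, fun ⟨G, hG⟩ => ⟨G, hG.1.1, ?_⟩⟩, ?_⟩
  · intro L hL
    have hG1 : ∀ u, γ * ‖u‖ ^ 2 ≤ qform G u := by
      intro u
      have := hG.2 ((γ : ℂ) • (1 : H →L[ℂ] H))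
        ⟨⟨sasmul γ (IsSelfAdjoint.one _), fun A hA v => by
          rw [qform_rsmul, qform_one']; exact hlow A hA v⟩, fun v => by
          rw [qform_rsmul, qform_one', qform_zero']; positivity⟩ u
      rwa [qform_rsmul, qform_one'] at this
    have hd : 0 < ‖L‖ + γ := by positivity
    set t : ℝ := γ / (‖L‖ + γ) with ht
    have ht0 : 0 < t := by positivity
    have ht1 : 0 ≤ 1 - t := by
      rw [ht, sub_nonneg, div_le_one hd]; linarith [norm_nonneg L]
    have hte : t * ‖L‖ = (1 - t) * γ := by
      rw [ht]; field_simp; ring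
    have hq : ∀ v, qform ((t : ℂ) • L + ((1 - t : ℝ) : ℂ) • G) v
        = t * qform L v + (1 - t) * qform G v := fun v => by
      rw [qform_add', qform_rsmul, qform_rsmul]
    have hX := hG.2 ((t : ℂ) • L + ((1 - t : ℝ) : ℂ) • G)
      ⟨⟨(sasmul t hL.1).add (sasmul _ hG.1.1.1), fun A hA v => by
        rw [hq]
        have a := mul_le_mul_of_nonneg_left (hL.2 A hA v) ht0.le
        have b := mul_le_mul_of_nonneg_left (hG.1.1.2 A hA v) ht1
        linarith⟩, fun v => by
        rw [hq, qform_zero']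
        have a := mul_le_mul_of_nonneg_left (neg_le_qform L v) ht0.le
        have b := mul_le_mul_of_nonneg_left (hG1 v) ht1
        have c : t * (‖L‖ * ‖v‖ ^ 2) = (1 - t) * (γ * ‖v‖ ^ 2) := by
          rw [← mul_assoc, hte, mul_assoc]
        linarith⟩
    intro u
    have := hX u
    rw [hq] at this
    have h5 : t * qform L u ≤ t * qform G u := by linarith
    exact le_of_mul_le_mul_left h5 ht0
  · intro G G' hG hG'
    exact loewner_antisymm hG.1.1 hG'.1.1.1 (hG'.2 G (fwd G hG).1) (hG.2 G' hG'.1.1)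
end
end
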